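/- arXiv:2002.12422 — 2 statements merged into one kernel-verified Lean document; each statement's English description precedes it below -/
import Mathlib

section
/- The set of normalized horofunctions of (V, ν) is exactly the union of the set {u ↦ ν(p−u) − ν(p) : p ∈ V} and the set {u ↦ ν_L(p−u) − ν_L(p) : p ∈ V, L ⊆ K a dual face}. That is, the closure of {u ↦ ν(p−u) − ν(p) : p ∈ V} in the space of real-valued functions on V with the topology of uniform convergence on bounded subsets of V equals this union. -/
open Bornology

/-- The polyhedral asymmetric norm `ν(u) = max {ξ_k(u) : k ∈ K}`. -/
noncomputable def nu {V : Type*} [AddCommGroup V] [Module ℝ V] {m : ℕ}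
    (ξ : Fin (m + 1) → V →ₗ[ℝ] ℝ) (u : V) : ℝ :=
  Finset.univ.sup' Finset.univ_nonempty fun k => ξ k u

/-- `ν_L(u) = max {ξ_ℓ(u) : ℓ ∈ L}` (junk value `0` for `L = ∅`). -/
noncomputable def nuL {V : Type*} [AddCommGroup V] [Module ℝ V] {m : ℕ}
    (ξ : Fin (m + 1) → V →ₗ[ℝ] ℝ) (L : Finset (Fin (m + 1))) (u : V) : ℝ :=
  if h : L.Nonempty then L.sup' h fun ℓ => ξ ℓ u else 0

/-- `L ⊆ K` is a dual face if there is `v` with `ν(v) = 1` and `L = {k : ξ_k(v) = 1}`. -/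
def IsDualFace {V : Type*} [AddCommGroup V] [Module ℝ V] {m : ℕ}
    (ξ : Fin (m + 1) → V →ₗ[ℝ] ℝ) (L : Finset (Fin (m + 1))) : Prop :=
  ∃ v : V, nu ξ v = 1 ∧ ∀ k, k ∈ L ↔ ξ k v = 1

/-- `H_L = {u : ξ_k(u) = ξ_ℓ(u) for all k, ℓ ∈ L}`. -/
def HL {V : Type*} [AddCommGroup V] [Module ℝ V] {m : ℕ}
    (ξ : Fin (m + 1) → V →ₗ[ℝ] ℝ) (L : Finset (Fin (m + 1))) : Set V :=
  {u : V | ∀ k ∈ L, ∀ l ∈ L, ξ k u = ξ l u}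

theorem aux_nuL_spec {V : Type*} [AddCommGroup V] [Module ℝ V] {m : ℕ}
    (ξ : Fin (m + 1) → V →ₗ[ℝ] ℝ) (L : Finset (Fin (m + 1))) (u : V) (r : ℝ)
    (h1 : ∀ k ∈ L, ξ k u ≤ r) (h2 : ∃ k ∈ L, ξ k u = r) : nuL ξ L u = r := by
  obtain ⟨k, hk, hr⟩ := h2
  have hL : L.Nonempty := ⟨k, hk⟩
  rw [nuL, dif_pos hL]
  apply le_antisymm
  · exact Finset.sup'_le _ _ h1
  · rw [← hr]
    exact Finset.le_sup' (fun l => ξ l u) hk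

theorem aux_nuL_le {V : Type*} [AddCommGroup V] [Module ℝ V] {m : ℕ}
    (ξ : Fin (m + 1) → V →ₗ[ℝ] ℝ) (L : Finset (Fin (m + 1))) (u : V)
    (k : Fin (m + 1)) (hk : k ∈ L) : ξ k u ≤ nuL ξ L u := by
  have hL : L.Nonempty := ⟨k, hk⟩
  rw [nuL, dif_pos hL]
  exact Finset.le_sup' (fun l => ξ l u) hk

theorem aux_nuL_ex {V : Type*} [AddCommGroup V] [Module ℝ V] {m : ℕ}
    (ξ : Fin (m + 1) → V →ₗ[ℝ] ℝ) (L : Finset (Fin (m + 1))) (hL : L.Nonempty) (u : V) :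
    ∃ k ∈ L, ξ k u = nuL ξ L u := by
  rw [nuL, dif_pos hL]
  obtain ⟨k, hk, h⟩ := Finset.exists_mem_eq_sup' hL (fun l => ξ l u)
  exact ⟨k, hk, h.symm⟩

theorem aux_nu_eq {V : Type*} [AddCommGroup V] [Module ℝ V] {m : ℕ}
    (ξ : Fin (m + 1) → V →ₗ[ℝ] ℝ) (u : V) : nu ξ u = nuL ξ Finset.univ u := by
  rw [nuL, dif_pos Finset.univ_nonempty, nu]

theorem aux_nu_le {V : Type*} [AddCommGroup V] [Module ℝ V] {m : ℕ}
    (ξ : Fin (m + 1) → V →ₗ[ℝ] ℝ) (u : V) (k : Fin (m + 1)) : ξ k u ≤ nu ξ u := by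
  rw [aux_nu_eq]
  exact aux_nuL_le ξ _ u k (Finset.mem_univ k)

theorem aux_nu_ex {V : Type*} [AddCommGroup V] [Module ℝ V] {m : ℕ}
    (ξ : Fin (m + 1) → V →ₗ[ℝ] ℝ) (u : V) : ∃ k, ξ k u = nu ξ u := by
  rw [aux_nu_eq]
  obtain ⟨k, _, h⟩ := aux_nuL_ex ξ Finset.univ Finset.univ_nonempty u
  exact ⟨k, h⟩

theorem aux_nu_spec {V : Type*} [AddCommGroup V] [Module ℝ V] {m : ℕ}
    (ξ : Fin (m + 1) → V →ₗ[ℝ] ℝ) (u : V) (r : ℝ)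
    (h1 : ∀ k, ξ k u ≤ r) (h2 : ∃ k, ξ k u = r) : nu ξ u = r := by
  rw [aux_nu_eq]
  obtain ⟨k, hk⟩ := h2
  exact aux_nuL_spec ξ _ u r (fun k _ => h1 k) ⟨k, Finset.mem_univ k, hk⟩

theorem aux_ultra_pick {α : Type*} {n : ℕ} (U : Ultrafilter α) (P : Fin n → α → Prop)
    (h : ∀ x, ∃ k, P k x) : ∃ k, ∀ᶠ x in (U : Filter α), P k x := by
  by_contra hcon
  push Not at hcon
  have h2 : ∀ k, ∀ᶠ x in (U : Filter α), ¬ P k x := hcon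
  have h3 := Filter.eventually_all.2 h2
  obtain ⟨x, hx⟩ := h3.exists
  obtain ⟨k, hk⟩ := h x
  exact hx k hk

/-- a generalized inverse of a linear map. -/
theorem aux_ginv {A B : Type*} [AddCommGroup A] [Module ℝ A] [AddCommGroup B] [Module ℝ B]
    (Φ : A →ₗ[ℝ] B) : ∃ G : B →ₗ[ℝ] A, ∀ a, Φ (G (Φ a)) = Φ a := by
  obtain ⟨g, hg⟩ := Φ.rangeRestrict.exists_rightInverse_of_surjective Φ.range_rangeRestrict
  obtain ⟨G, hG⟩ := LinearMap.exists_extend g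
  refine ⟨G, fun a => ?_⟩
  have h1 : G (Φ a) = g (Φ.rangeRestrict a) := by
    rw [← hG]; rfl
  have h2 := LinearMap.congr_fun hg (Φ.rangeRestrict a)
  have h3 := congrArg Subtype.val h2
  rw [h1]
  simpa using h3

/-- limits of the functions `u ↦ ν(p-u) - ν(p)` along an ultrafilter. -/
theorem aux_forward
    {V : Type*} [NormedAddCommGroup V] [InnerProductSpace ℝ V] [FiniteDimensional ℝ V]
    {m : ℕ} (ξ : Fin (m + 1) → V →ₗ[ℝ] ℝ)
    (hpos : ∀ u : V, u ≠ 0 → 0 < nu ξ u) (U : Ultrafilter V) (f : V → ℝ)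
    (hf : ∀ u, Filter.Tendsto (fun p => nu ξ (p - u) - nu ξ p) U (nhds (f u))) :
    ∃ q : V, ∃ L : Finset (Fin (m + 1)), (L = Finset.univ ∨ IsDualFace ξ L) ∧
      f = fun u => nuL ξ L (q - u) - nuL ξ L q := by
  classical
  let d : Fin (m + 1) → V → ℝ := fun k p => nu ξ p - ξ k p
  have hd0 : ∀ k p, 0 ≤ d k p := fun k p => sub_nonneg.2 (aux_nu_le ξ p k)
  let L : Finset (Fin (m + 1)) :=
    Finset.univ.filter fun k => ∃ c, Filter.Tendsto (d k) U (nhds c)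
  have hL : ∀ k, k ∈ L ↔ ∃ c, Filter.Tendsto (d k) U (nhds c) := fun k => by simp [L]
  have hnL : ∀ k, k ∉ L → ∀ B : ℝ, ∀ᶠ p in (U : Filter V), B < d k p := by
    intro k hk B
    by_contra hcon
    apply hk
    rw [hL]
    have h1 : ∀ᶠ p in (U : Filter V), d k p ∈ Set.Icc 0 B := by
      filter_upwards [Ultrafilter.eventually_not.2 hcon] with p hp
      exact ⟨hd0 k p, not_lt.1 hp⟩
    obtain ⟨c, _, hc⟩ := (isCompact_Icc (a := (0 : ℝ)) (b := B)).ultrafilter_le_nhds'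
      (U.map (d k)) h1
    exact ⟨c, hc⟩
  let Φ : V × ℝ →ₗ[ℝ] (L → ℝ) := LinearMap.pi fun k =>
    (ξ k).comp (LinearMap.fst ℝ V ℝ) + LinearMap.snd ℝ V ℝ
  have hΦ : ∀ a k, Φ a k = ξ k a.1 + a.2 := fun a k => by simp [Φ]
  obtain ⟨G, hG⟩ := aux_ginv Φ
  choose c hc using fun k : L => (hL k).1 k.2
  let s : V → V × ℝ := fun p => G (Φ (p, - nu ξ p))
  have hs : ∀ p, ∀ k ∈ L, ξ k (s p).1 + (s p).2 = - d k p := by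
    intro p k hk
    have h1 := congrFun (hG (p, - nu ξ p)) ⟨k, hk⟩
    rw [hΦ, hΦ] at h1
    simp only [d, s]
    simp only at h1
    linarith
  have hlim : Filter.Tendsto s U (nhds (G fun k => - c k)) := by
    have hGc : Continuous G := LinearMap.continuous_of_finiteDimensional G
    refine (hGc.tendsto _).comp ?_
    rw [tendsto_pi_nhds]
    intro k
    refine (hc k).neg.congr fun p => ?_
    rw [hΦ]
    simp only [d]
    ring
  set q : V := (G fun k => - c k).1 with hq
  set t : ℝ := (G fun k => - c k).2 with ht
  have hlim1 : Filter.Tendsto (fun p => (s p).1) U (nhds q) :=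
    (continuous_fst.tendsto _).comp hlim
  have hlim2 : Filter.Tendsto (fun p => (s p).2) U (nhds t) :=
    (continuous_snd.tendsto _).comp hlim
  have hξc : ∀ k, Continuous (ξ k) := fun k => LinearMap.continuous_of_finiteDimensional _
  have hξ1 : ∀ k, Filter.Tendsto (fun p => ξ k (s p).1) U (nhds (ξ k q)) := fun k =>
    ((hξc k).tendsto _).comp hlim1
  have hdlim : ∀ k ∈ L, Filter.Tendsto (d k) U (nhds (-(ξ k q + t))) := by
    intro k hk
    refine ((hξ1 k).add hlim2).neg.congr fun p => ?_
    rw [hs p k hk]; ring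
  have hval : ∀ u, nuL ξ L (q - u) = f u - t := by
    intro u
    apply aux_nuL_spec
    · intro k hk
      have h1 : -ξ k u - -(ξ k q + t) ≤ f u := by
        refine le_of_tendsto_of_tendsto' (tendsto_const_nhds.sub (hdlim k hk)) (hf u) fun p => ?_
        have := aux_nu_le ξ (p - u) k
        rw [map_sub] at this
        simp only [d]
        linarith
      rw [map_sub]; linarith
    · obtain ⟨k, hk⟩ := aux_ultra_pick U (fun k p => ξ k (p - u) = nu ξ (p - u))
        (fun p => aux_nu_ex ξ (p - u))
      have hdk : Filter.Tendsto (d k) U (nhds (-ξ k u - f u)) := by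
        refine ((tendsto_const_nhds (x := -ξ k u)).sub (hf u)).congr' ?_
        filter_upwards [hk] with p hp
        rw [← hp, map_sub]
        simp only [d]
        ring
      have hkL : k ∈ L := (hL k).2 ⟨_, hdk⟩
      have := tendsto_nhds_unique hdk (hdlim k hkL)
      refine ⟨k, hkL, ?_⟩
      rw [map_sub]; linarith
  have hf0 : f 0 = 0 := by
    refine tendsto_nhds_unique (hf 0) ?_
    simp
  refine ⟨q, L, ?_, ?_⟩
  · by_cases hLu : L = Finset.univ
    · exact Or.inl hLu
    right
    have hLne : L.Nonempty := by
      obtain ⟨k, hk⟩ := aux_ultra_pick U (fun k p => ξ k p = nu ξ p) (fun p => aux_nu_ex ξ p)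
      refine ⟨k, (hL k).2 ⟨0, ?_⟩⟩
      refine tendsto_const_nhds.congr' ?_
      filter_upwards [hk] with p hp
      simp [d, hp]
    have hev : ∀ᶠ p in (U : Filter V), ∀ k, k ∉ L →
        ξ k (p - (s p).1) < nu ξ p + (s p).2 := by
      rw [Filter.eventually_all]
      intro k
      by_cases hk : k ∈ L
      · exact Filter.Eventually.of_forall fun p h => absurd hk h
      have h1 := hnL k hk (-(ξ k q + t) + 1)
      have h2 := (((hξ1 k).add hlim2).neg).eventually_lt_const
        (lt_add_one (-(ξ k q + t)))
      filter_upwards [h1, h2] with p h1 h2 _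
      rw [map_sub]
      simp only [d] at h1
      linarith
    obtain ⟨p, hp⟩ := hev.exists
    set w := p - (s p).1 with hw
    set r := nu ξ p + (s p).2 with hr
    have hwL : ∀ k ∈ L, ξ k w = r := by
      intro k hk
      have := hs p k hk
      simp only [d] at this
      rw [hw, map_sub]; linarith
    have hnw : nu ξ w = r := by
      apply aux_nu_spec
      · intro k
        by_cases hk : k ∈ L
        · exact (hwL k hk).le
        · exact (hp k hk).le
      · obtain ⟨k, hk⟩ := hLne
        exact ⟨k, hwL k hk⟩
    have hw0 : w ≠ 0 := by
      intro h0
      obtain ⟨k, hk⟩ : ∃ k, k ∉ L := by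
        by_contra hcon
        push Not at hcon
        exact hLu (Finset.eq_univ_iff_forall.2 hcon)
      obtain ⟨l, hl⟩ := hLne
      have h1 := hp k hk
      have h2 := hwL l hl
      rw [h0, map_zero] at h1 h2
      linarith
    have hr0 : 0 < r := hnw ▸ hpos w hw0
    have hmul : ∀ k, ξ k (r⁻¹ • w) = r⁻¹ * ξ k w := fun k => by simp
    have hrr : r⁻¹ * r = 1 := inv_mul_cancel₀ hr0.ne'
    have hri : 0 < r⁻¹ := inv_pos.2 hr0
    refine ⟨r⁻¹ • w, ?_, ?_⟩
    · apply aux_nu_spec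
      · intro k
        rw [hmul, ← hrr]
        exact mul_le_mul_of_nonneg_left (hnw ▸ aux_nu_le ξ w k) hri.le
      · obtain ⟨k, hk⟩ := hLne
        exact ⟨k, by rw [hmul, hwL k hk, hrr]⟩
    · intro k
      constructor
      · intro hk
        rw [hmul, hwL k hk, hrr]
      · intro h
        by_contra hk
        have := mul_lt_mul_of_pos_left (hp k hk) hri
        rw [hmul] at h
        linarith
  · funext u
    have h1 := hval u
    have h2 := hval 0
    rw [sub_zero] at h2
    rw [h1, h2, hf0]; ring

/-- On a bounded set, the functions based at `p + n v` are eventually equal to the limit. -/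
theorem aux_backward
    {V : Type*} [NormedAddCommGroup V] [InnerProductSpace ℝ V] [FiniteDimensional ℝ V]
    {m : ℕ} (ξ : Fin (m + 1) → V →ₗ[ℝ] ℝ) (L : Finset (Fin (m + 1))) (hL : L.Nonempty)
    (v p : V) (hv : nu ξ v = 1) (hvL : ∀ k, k ∈ L ↔ ξ k v = 1) (s : Set V) (hs : IsBounded s) :
    ∀ᶠ n : ℕ in Filter.atTop, ∀ u ∈ s,
      nu ξ (p + (n : ℝ) • v - u) = n + nuL ξ L (p - u) := by
  obtain ⟨k0, hk0⟩ := hL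
  have hC : ∀ k, ∃ C : ℝ, ∀ u ∈ s, ξ k (p - u) - ξ k0 (p - u) ≤ C := by
    intro k
    have hcont : Continuous fun u => ξ k (p - u) - ξ k0 (p - u) := by
      have h1 : Continuous (ξ k) := LinearMap.continuous_of_finiteDimensional _
      have h2 : Continuous (ξ k0) := LinearMap.continuous_of_finiteDimensional _
      fun_prop
    haveI : ProperSpace V := FiniteDimensional.proper ℝ V
    have hcomp : IsCompact (closure s) := hs.isCompact_closure
    obtain ⟨C, hC⟩ := hcomp.bddAbove_image hcont.continuousOn
    exact ⟨C, fun u hu => hC ⟨u, subset_closure hu, rfl⟩⟩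
  have hev : ∀ᶠ n : ℕ in Filter.atTop, ∀ k, k ∉ L → ∀ u ∈ s,
      ξ k (p - u) + n * ξ k v ≤ n + ξ k0 (p - u) := by
    rw [Filter.eventually_all]
    intro k
    by_cases hk : k ∈ L
    · exact Filter.Eventually.of_forall fun n h => absurd hk h
    have hlt : ξ k v < 1 := lt_of_le_of_ne (hv ▸ aux_nu_le ξ v k) fun h => hk ((hvL k).2 h)
    obtain ⟨C, hC⟩ := hC k
    obtain ⟨N, hN⟩ := exists_nat_ge (C / (1 - ξ k v))
    filter_upwards [Filter.eventually_ge_atTop N] with n hn _ u hu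
    have h1 : C / (1 - ξ k v) ≤ n := hN.trans (by exact_mod_cast hn)
    rw [div_le_iff₀ (by linarith)] at h1
    have := hC u hu
    linarith
  filter_upwards [hev] with n hn u hu
  have hexp : ∀ k, ξ k (p + (n : ℝ) • v - u) = ξ k (p - u) + n * ξ k v := by
    intro k; simp; ring
  apply aux_nu_spec
  · intro k
    rw [hexp]
    by_cases hk : k ∈ L
    · rw [(hvL k).1 hk]
      have := aux_nuL_le ξ L (p - u) k hk
      linarith
    · have h1 := hn k hk u hu
      have := aux_nuL_le ξ L (p - u) k0 hk0
      linarith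
  · obtain ⟨k, hk, h⟩ := aux_nuL_ex ξ L ⟨k0, hk0⟩ (p - u)
    refine ⟨k, ?_⟩
    rw [hexp, (hvL k).1 hk, h]; ring

/-- The normalized horofunctions of `(V,ν)` — the elements of the closure
of `{u ↦ ν(p−u) − ν(p) : p ∈ V}` in the topology of uniform convergence on bounded sets —
are exactly the functions `u ↦ ν(p−u) − ν(p)` for `p ∈ V` together with the functions
`u ↦ ν_L(p−u) − ν_L(p)` for `p ∈ V` and `L` a dual face. -/
theorem horofunctions_of_polyhedral_norm
    {V : Type*} [NormedAddCommGroup V] [InnerProductSpace ℝ V] [FiniteDimensional ℝ V]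
    {m : ℕ} (ξ : Fin (m + 1) → V →ₗ[ℝ] ℝ)
    (hfacet : ∀ k, ∃ u : V, ξ k u = 1 ∧ ∀ l, l ≠ k → ξ l u < 1)
    (hpos : ∀ u : V, u ≠ 0 → 0 < nu ξ u) :
    closure (UniformOnFun.ofFun {s : Set V | IsBounded s} ''
        {f : V → ℝ | ∃ p : V, f = fun u => nu ξ (p - u) - nu ξ p})
      = UniformOnFun.ofFun {s : Set V | IsBounded s} ''
        ({f : V → ℝ | ∃ p : V, f = fun u => nu ξ (p - u) - nu ξ p} ∪
         {f : V → ℝ | ∃ p : V, ∃ L : Finset (Fin (m + 1)), IsDualFace ξ L ∧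
            f = fun u => nuL ξ L (p - u) - nuL ξ L p}) := by
  apply Set.Subset.antisymm
  · intro g hg
    have hrange : (UniformOnFun.ofFun {s : Set V | IsBounded s} ''
        {f : V → ℝ | ∃ p : V, f = fun u => nu ξ (p - u) - nu ξ p}) =
        Set.range fun p : V => UniformOnFun.ofFun {s : Set V | IsBounded s}
          (fun u => nu ξ (p - u) - nu ξ p) := by
      ext x
      constructor
      · rintro ⟨f, ⟨p, rfl⟩, rfl⟩
        exact ⟨p, rfl⟩
      · rintro ⟨p, rfl⟩
        exact ⟨_, ⟨p, rfl⟩, rfl⟩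
    rw [hrange, ← Set.image_univ, mem_closure_iff_clusterPt, ← Filter.map_principal] at hg
    obtain ⟨U, _, hU⟩ := mapClusterPt_iff_ultrafilter.1 hg
    rw [UniformOnFun.tendsto_iff_tendstoUniformlyOn] at hU
    obtain ⟨q, L, hL, h⟩ := aux_forward ξ hpos U
      (UniformOnFun.toFun {s : Set V | IsBounded s} g) (fun u => by
        exact (hU {u} Bornology.isBounded_singleton).tendsto_at (Set.mem_singleton u))
    refine ⟨UniformOnFun.toFun {s : Set V | IsBounded s} g, ?_, rfl⟩
    rcases hL with rfl | hL
    · left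
      refine ⟨q, ?_⟩
      rw [h]
      funext u
      rw [aux_nu_eq, aux_nu_eq]
    · right
      exact ⟨q, L, hL, h⟩
  · rintro _ ⟨f, hf | ⟨p, L, ⟨v, hv, hvL⟩, rfl⟩, rfl⟩
    · exact subset_closure ⟨f, hf, rfl⟩
    · have hne : L.Nonempty := by
        obtain ⟨k, hk⟩ := aux_nu_ex ξ v
        exact ⟨k, (hvL k).2 (hk.trans hv)⟩
      refine mem_closure_of_tendsto (b := Filter.atTop)
        (f := fun n : ℕ => UniformOnFun.ofFun {s : Set V | IsBounded s}
          (fun u => nu ξ (p + (n : ℝ) • v - u) - nu ξ (p + (n : ℝ) • v))) ?_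
        (Filter.Eventually.of_forall fun n => ⟨_, ⟨_, rfl⟩, rfl⟩)
      rw [UniformOnFun.tendsto_iff_tendstoUniformlyOn]
      intro s hs
      rw [Metric.tendstoUniformlyOn_iff]
      intro ε hε
      filter_upwards [aux_backward ξ L hne v p hv hvL s hs,
        aux_backward ξ L hne v p hv hvL {0} Bornology.isBounded_singleton] with n h1 h2 u hu
      have h3 := h1 u hu
      have h4 := h2 0 rfl
      rw [sub_zero, sub_zero] at h4
      simp only [Function.comp, UniformOnFun.toFun_ofFun]
      rw [h3, h4]
      simpa using hε
end

section
/- Let X and Y be compact Hausdorff topological spaces, let A ⊆ X and B ⊆ Y be closed subsets, and let f : X → Y be a continuous map with A = f⁻¹(B). Assume that the restriction of f to X∖A is injective and is an open map onto its image in Y∖B, and that both X∖A and Y∖B are homeomorphic to ℝⁿ for some n. Then the restriction f : X∖A → Y∖B is surjective, i.e. f(X∖A) = Y∖B. -/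
open MeasureTheory Metric Set

theorem det_poly_aux {n : ℕ} (T : EuclideanSpace ℝ (Fin n) →L[ℝ] EuclideanSpace ℝ (Fin n)) :
    ∃ p : Polynomial ℝ, p.natDegree ≤ n ∧
      ∀ t : ℝ, p.eval t = (ContinuousLinearMap.id ℝ _ + t • T).det := by
  classical
  let b := (EuclideanSpace.basisFun (Fin n) ℝ).toBasis
  let A : Matrix (Fin n) (Fin n) ℝ := LinearMap.toMatrix b b T.toLinearMap
  refine ⟨Matrix.det ((Polynomial.X : Polynomial ℝ) • A.map Polynomial.C
    + (1 : Matrix (Fin n) (Fin n) ℝ).map Polynomial.C), ?_, fun t => ?_⟩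
  · simpa using Polynomial.natDegree_det_X_add_C_le A 1
  · rw [ContinuousLinearMap.det, ← LinearMap.det_toMatrix b, ← Polynomial.coe_evalRingHom,
      RingHom.map_det]
    congr 1
    have : ((ContinuousLinearMap.id ℝ (EuclideanSpace ℝ (Fin n)) + t • T :
        EuclideanSpace ℝ (Fin n) →L[ℝ] EuclideanSpace ℝ (Fin n)) : _ →ₗ[ℝ] _)
        = LinearMap.id + t • T.toLinearMap := rfl
    have e : LinearMap.toMatrix b b (LinearMap.id + t • T.toLinearMap) = 1 + t • A := by
      rw [map_add, map_smul, LinearMap.toMatrix_id]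
    rw [this, e]
    ext i j
    by_cases h : i = j <;> simp [h] <;> ring

theorem det_interp_aux {n : ℕ} (ε : ℝ) (hε : 0 < ε) :
    ∃ (c t : ℕ → ℝ), (∀ i, 0 < t i ∧ t i < ε) ∧ (∑ i ∈ Finset.range (n+1), c i = 1) ∧
      ∀ T : EuclideanSpace ℝ (Fin n) →L[ℝ] EuclideanSpace ℝ (Fin n),
        ∑ i ∈ Finset.range (n+1), c i * (ContinuousLinearMap.id ℝ _ + t i • T).det
          = (ContinuousLinearMap.id ℝ _ + T).det := by
  let t : ℕ → ℝ := fun i => ε / (i + 2)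
  have hinj : Function.Injective t := by
    intro i j h
    have h1 : (i : ℝ) + 2 ≠ 0 := by positivity
    have h2 : (j : ℝ) + 2 ≠ 0 := by positivity
    simp only [t] at h
    rw [div_eq_div_iff h1 h2] at h
    have := mul_left_cancel₀ hε.ne' h
    have : (i : ℝ) = j := by linarith
    exact_mod_cast this
  let s := Finset.range (n+1)
  have key : ∀ p : Polynomial ℝ, p.natDegree ≤ n →
      ∑ i ∈ s, (Lagrange.basis s t i).eval 1 * p.eval (t i) = p.eval 1 := by
    intro p hp
    have hd : p.degree < s.card := by
      simp only [s, Finset.card_range]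
      exact lt_of_le_of_lt Polynomial.degree_le_natDegree (by exact_mod_cast Nat.lt_succ_of_le hp)
    have := Lagrange.eq_interpolate (s := s) (v := t) hinj.injOn hd
    conv_rhs => rw [this]
    rw [Lagrange.interpolate_apply, Polynomial.eval_finsetSum]
    refine Finset.sum_congr rfl fun i _ => ?_
    simp [mul_comm]
  refine ⟨fun i => (Lagrange.basis s t i).eval 1, t, fun i => ⟨by positivity, ?_⟩, ?_, fun T => ?_⟩
  · exact div_lt_self hε (by have : (0:ℝ) ≤ i := by positivity
                             linarith)
  · simpa using key 1 (by simp)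
  · obtain ⟨p, hp, hpe⟩ := det_poly_aux T
    have := key p hp
    simp only [hpe, one_smul] at this
    exact this

theorem glue_lip {n : ℕ} {M : ℝ} {K : NNReal}
    (h : EuclideanSpace ℝ (Fin n) → EuclideanSpace ℝ (Fin n))
    (hl : LipschitzOnWith K h (closedBall 0 M)) (h0 : ∀ x, M ≤ ‖x‖ → h x = 0) :
    LipschitzWith K h := by
  have main : ∀ x y, ‖x‖ ≤ M → M ≤ ‖y‖ → dist (h x) (h y) ≤ K * dist x y := by
    intro x y hx hy
    have : ∃ s ∈ Icc (0:ℝ) 1, ‖AffineMap.lineMap x y s‖ = M := by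
      have hc : ContinuousOn (fun s : ℝ => ‖AffineMap.lineMap (k := ℝ) x y s‖) (Icc 0 1) :=
        (AffineMap.lineMap_continuous.norm).continuousOn
      have := intermediate_value_Icc (zero_le_one) hc
      simp only [AffineMap.lineMap_apply_zero, AffineMap.lineMap_apply_one] at this
      exact this ⟨hx, hy⟩
    obtain ⟨s, hs, hz⟩ := this
    rw [h0 y hy, ← h0 _ hz.ge]
    refine (hl.dist_le_mul x (by simpa using hx) _ (by simp [hz])).trans ?_
    gcongr
    rw [dist_left_lineMap, Real.norm_of_nonneg hs.1]
    exact mul_le_of_le_one_left dist_nonneg hs.2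
  refine LipschitzWith.of_dist_le_mul fun x y => ?_
  rcases le_total ‖x‖ M with hx | hx <;> rcases le_total ‖y‖ M with hy | hy
  · exact hl.dist_le_mul x (by simpa using hx) y (by simpa using hy)
  · exact main x y hx hy
  · rw [dist_comm, dist_comm x]; exact main y x hy hx
  · rw [h0 x hx, h0 y hy, dist_self]; positivity

theorem no_retraction {n : ℕ} {M : ℝ} (hM : 0 < M)
    (r : EuclideanSpace ℝ (Fin n) → EuclideanSpace ℝ (Fin n)) (hr : ContDiff ℝ 1 r)
    (hrM : ∀ x, ‖r x‖ = M) (hrid : ∀ x, ‖x‖ = M → r x = x) : False := by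
  classical
  let I : EuclideanSpace ℝ (Fin n) →L[ℝ] EuclideanSpace ℝ (Fin n) := ContinuousLinearMap.id ℝ (EuclideanSpace ℝ (Fin n))
  have hd : Differentiable ℝ r := hr.differentiable (by norm_num)
  have hcD : Continuous (fun x => fderiv ℝ r x - I) :=
    (hr.continuous_fderiv (by norm_num)).sub continuous_const
  have hdet0 : ∀ x, (fderiv ℝ r x).det = 0 := by
    intro x
    by_contra hne
    have hu : IsUnit (LinearMap.det (fderiv ℝ r x : EuclideanSpace ℝ (Fin n) →ₗ[ℝ] EuclideanSpace ℝ (Fin n))) := isUnit_iff_ne_zero.2 hne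
    have hsurj : Function.Surjective (fderiv ℝ r x) := by
      have h1 := (LinearMap.isUnit_iff_isUnit_det _).2 hu
      exact ((Module.End.isUnit_iff _).1 h1).2
    obtain ⟨v, hv⟩ := hsurj (r x)
    have h1 : HasFDerivAt (fun y => ‖r y‖ ^ 2) (2 • (innerSL ℝ (r x)).comp (fderiv ℝ r x)) x :=
      (hd x).hasFDerivAt.norm_sq
    have h2 : HasFDerivAt (fun y => ‖r y‖ ^ 2) (0 : EuclideanSpace ℝ (Fin n) →L[ℝ] ℝ) x := by
      simp only [hrM]; exact hasFDerivAt_const _ _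
    have h3 := congrArg (fun L : EuclideanSpace ℝ (Fin n) →L[ℝ] ℝ => L v) (h1.unique h2)
    simp [hv, hrM] at h3
    exact hM.ne' h3
  obtain ⟨K0, hK0⟩ := (isCompact_closedBall (0 : EuclideanSpace ℝ (Fin n)) M).exists_bound_of_continuousOn hcD.continuousOn
  let K : NNReal := ⟨max K0 0, le_max_right _ _⟩
  have hK : ∀ x ∈ closedBall (0 : EuclideanSpace ℝ (Fin n)) M, ‖fderiv ℝ r x - I‖ ≤ K := fun x hx =>
    (hK0 x hx).trans (le_max_left _ _)
  have hder : ∀ x, HasFDerivAt (fun y => r y - y) (fderiv ℝ r x - I) x := fun x =>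
    (hd x).hasFDerivAt.sub (hasFDerivAt_id x)
  let h : EuclideanSpace ℝ (Fin n) → EuclideanSpace ℝ (Fin n) := fun x => if ‖x‖ ≤ M then r x - x else 0
  have hh0 : ∀ x, M ≤ ‖x‖ → h x = 0 := by
    intro x hx
    by_cases h1 : ‖x‖ ≤ M
    · simp [h, h1, hrid x (le_antisymm h1 hx)]
    · simp [h, h1]
  have hlipOn : LipschitzOnWith K h (closedBall 0 M) := by
    have : LipschitzOnWith K (fun y => r y - y) (closedBall 0 M) :=
      (convex_closedBall (0 : EuclideanSpace ℝ (Fin n)) M).lipschitzOnWith_of_nnnorm_hasFDerivWithin_le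
        (fun x _ => (hder x).hasFDerivWithinAt) (fun x hx => hK x hx)
    intro x hx y hy
    have e1 : h x = r x - x := if_pos (by simpa using hx)
    have e2 : h y = r y - y := if_pos (by simpa using hy)
    rw [e1, e2]; exact this hx hy
  have hlip : LipschitzWith K h := glue_lip h hlipOn hh0
  obtain ⟨δ, hδ, hpos⟩ : ∃ δ > 0, ∀ T : EuclideanSpace ℝ (Fin n) →L[ℝ] EuclideanSpace ℝ (Fin n), ‖T‖ < δ → 0 < (I + T).det := by
    have hc : Continuous (fun T : EuclideanSpace ℝ (Fin n) →L[ℝ] EuclideanSpace ℝ (Fin n) => (I + T).det) :=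
      ContinuousLinearMap.continuous_det.comp (continuous_const.add continuous_id)
    have h0 : 0 < (I + (0 : EuclideanSpace ℝ (Fin n) →L[ℝ] EuclideanSpace ℝ (Fin n))).det := by simp [I, ContinuousLinearMap.det]
    obtain ⟨δ, hδ, hb⟩ := Metric.mem_nhds_iff.1 (hc.continuousAt.preimage_mem_nhds (Ioi_mem_nhds h0))
    exact ⟨δ, hδ, fun T hT => hb (by simpa using hT)⟩
  let ε : ℝ := min δ 1 / (K + 1)
  have hK1 : (0 : ℝ) < K + 1 := by positivity
  have hε : 0 < ε := by positivity
  have main : ∀ t : ℝ, 0 < t → t < ε →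
      IntegrableOn (fun x => (I + t • (fderiv ℝ r x - I)).det) (ball (0 : EuclideanSpace ℝ (Fin n)) M) ∧
      ∫ x in ball (0 : EuclideanSpace ℝ (Fin n)) M, (I + t • (fderiv ℝ r x - I)).det = volume.real (ball (0 : EuclideanSpace ℝ (Fin n)) M) := by
    intro t ht0 ht
    have htK : t * (K + 1) < min δ 1 := (lt_div_iff₀ hK1).1 ht
    have htK' : t * K < min δ 1 := by nlinarith
    let g : EuclideanSpace ℝ (Fin n) → EuclideanSpace ℝ (Fin n) := fun x => x + t • h x
    have happ : ApproximatesLinearOn g ((ContinuousLinearEquiv.refl ℝ (EuclideanSpace ℝ (Fin n)) : EuclideanSpace ℝ (Fin n) ≃L[ℝ] EuclideanSpace ℝ (Fin n)) : EuclideanSpace ℝ (Fin n) →L[ℝ] EuclideanSpace ℝ (Fin n))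
        univ (⟨t, ht0.le⟩ * K) := by
      intro x _ y _
      have : g x - g y - ((ContinuousLinearEquiv.refl ℝ (EuclideanSpace ℝ (Fin n)) : EuclideanSpace ℝ (Fin n) ≃L[ℝ] EuclideanSpace ℝ (Fin n)) : EuclideanSpace ℝ (Fin n) →L[ℝ] EuclideanSpace ℝ (Fin n)) (x - y)
          = t • (h x - h y) := by
        simp [g, smul_sub]; abel
      rw [this, norm_smul, Real.norm_of_nonneg ht0.le]
      have := hlip.dist_le_mul x y
      rw [dist_eq_norm, dist_eq_norm] at this
      calc t * ‖h x - h y‖ ≤ t * (K * ‖x - y‖) := by gcongr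
        _ = _ := by rw [← mul_assoc]; rfl
    have hc : Subsingleton (EuclideanSpace ℝ (Fin n)) ∨ (⟨t, ht0.le⟩ * K : NNReal) <
        ‖((ContinuousLinearEquiv.refl ℝ (EuclideanSpace ℝ (Fin n))).symm : EuclideanSpace ℝ (Fin n) →L[ℝ] EuclideanSpace ℝ (Fin n))‖₊⁻¹ := by
      rcases subsingleton_or_nontrivial (EuclideanSpace ℝ (Fin n)) with hs | hs
      · exact Or.inl hs
      · right
        have : ‖((ContinuousLinearEquiv.refl ℝ (EuclideanSpace ℝ (Fin n))).symm : EuclideanSpace ℝ (Fin n) →L[ℝ] EuclideanSpace ℝ (Fin n))‖₊ = 1 := by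
          ext; exact ContinuousLinearMap.norm_id
        rw [this, inv_one, ← NNReal.coe_lt_coe]
        exact htK'.trans_le (min_le_right _ _)
    have hgi : Function.Injective g := injOn_univ.1 (happ.injOn hc)
    have hgs : Function.Surjective g := happ.surjective hc
    have hgo : ∀ x, M ≤ ‖x‖ → g x = x := fun x hx => by simp [g, hh0 x hx]
    have himg : g '' ball 0 M = ball 0 M := by
      ext y
      constructor
      · rintro ⟨x, hx, rfl⟩
        by_contra hy
        have hy' : M ≤ ‖g x‖ := by simpa using hy
        have := hgi (hgo _ hy')
        rw [this] at hy'
        simp at hx; linarith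
      · intro hy
        obtain ⟨x, rfl⟩ := hgs y
        refine ⟨x, ?_, rfl⟩
        by_contra hx
        have hx' : M ≤ ‖x‖ := by simpa using hx
        rw [hgo x hx'] at hy
        exact hx hy
    have hgd : ∀ x ∈ ball (0 : EuclideanSpace ℝ (Fin n)) M,
        HasFDerivWithinAt g (I + t • (fderiv ℝ r x - I)) (ball 0 M) x := by
      intro x hx
      have h1 : HasFDerivAt (fun y => y + t • (r y - y)) (I + t • (fderiv ℝ r x - I)) x :=
        (hasFDerivAt_id x).add ((hder x).const_smul t)
      refine h1.hasFDerivWithinAt.congr ?_ ?_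
      · intro y hy
        have : ‖y‖ ≤ M := by simpa using (ball_subset_closedBall hy)
        simp [g, h, this]
      · have : ‖x‖ ≤ M := by simpa using (ball_subset_closedBall hx)
        simp [g, h, this]
    have habs : ∀ x ∈ ball (0 : EuclideanSpace ℝ (Fin n)) M, |(I + t • (fderiv ℝ r x - I)).det| • (1 : ℝ)
        = (I + t • (fderiv ℝ r x - I)).det := by
      intro x hx
      rw [smul_eq_mul, mul_one, abs_of_pos]
      apply hpos
      rw [norm_smul, Real.norm_of_nonneg ht0.le]
      calc t * ‖fderiv ℝ r x - I‖ ≤ t * K := by gcongr; exact hK x (ball_subset_closedBall hx)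
        _ < δ := htK'.trans_le (min_le_left _ _)
    have i1 := integrableOn_image_iff_integrableOn_abs_det_fderiv_smul volume
      measurableSet_ball hgd hgi.injOn (fun _ => (1 : ℝ))
    have i2 := integral_image_eq_integral_abs_det_fderiv_smul volume
      measurableSet_ball hgd hgi.injOn (fun _ => (1 : ℝ))
    rw [himg] at i1 i2
    constructor
    · refine (i1.1 ?_).congr_fun habs measurableSet_ball
      exact integrableOn_const measure_ball_lt_top.ne
    · rw [← setIntegral_congr_fun measurableSet_ball habs, ← i2]
      simp
  obtain ⟨c, t, ht, hc1, hint⟩ := det_interp_aux (n := n) ε hε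
  have hz : ∀ x, ∑ i ∈ Finset.range (n+1), c i * (I + t i • (fderiv ℝ r x - I)).det = 0 := by
    intro x
    rw [hint]
    have : ContinuousLinearMap.id ℝ (EuclideanSpace ℝ (Fin n)) + (fderiv ℝ r x - I) = fderiv ℝ r x := by
      simp [I]
    rw [this, hdet0]
  have : ∫ x in ball (0 : EuclideanSpace ℝ (Fin n)) M,
      ∑ i ∈ Finset.range (n+1), c i * (I + t i • (fderiv ℝ r x - I)).det
      = volume.real (ball (0 : EuclideanSpace ℝ (Fin n)) M) := by
    rw [integral_finsetSum]
    · simp_rw [integral_const_mul]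
      rw [Finset.sum_congr rfl fun i _ => by rw [(main (t i) (ht i).1 (ht i).2).2],
        ← Finset.sum_mul, hc1, one_mul]
    · intro i _
      exact (main (t i) (ht i).1 (ht i).2).1.const_mul _
  simp only [hz, integral_zero] at this
  have hp : 0 < volume.real (ball (0 : EuclideanSpace ℝ (Fin n)) M) :=
    ENNReal.toReal_pos (measure_ball_pos _ _ hM).ne' measure_ball_lt_top.ne
  exact hp.ne this

theorem bounded_fixed_point {n : ℕ}
    (φ : EuclideanSpace ℝ (Fin n) → EuclideanSpace ℝ (Fin n)) (hφ : Continuous φ)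
    {C : ℝ} (hC : ∀ x, ‖φ x‖ ≤ C) : ∃ x, φ x = x := by
  by_contra! hne
  have hC0 : 0 ≤ C := (norm_nonneg _).trans (hC 0)
  let χ : EuclideanSpace ℝ (Fin n) → ℝ := fun x => max 0 (min 1 (C + 2 - ‖x‖))
  let ψ : EuclideanSpace ℝ (Fin n) → EuclideanSpace ℝ (Fin n) := fun x => x - χ x • φ x
  have hψc : Continuous ψ := by fun_prop
  have hψ0 : ∀ x, ψ x ≠ 0 := by
    intro x hx
    have hx' : x = χ x • φ x := sub_eq_zero.1 hx
    rcases le_or_gt ‖x‖ (C + 1) with h | h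
    · have : χ x = 1 := by
        simp only [χ]
        rw [min_eq_left (by linarith), max_eq_right (by norm_num)]
      rw [this, one_smul] at hx'
      exact hne x hx'.symm
    · have h1 : ‖x‖ ≤ C := by
        have a0 : 0 ≤ χ x := le_max_left _ _
        have a1 : χ x ≤ 1 := max_le zero_le_one (min_le_left _ _)
        rw [hx', norm_smul, Real.norm_of_nonneg a0]
        have := hC x
        nlinarith [norm_nonneg (φ x)]
      linarith
  have hψid : ∀ x, C + 2 ≤ ‖x‖ → ψ x = x := by
    intro x hx
    have : χ x = 0 := by
      simp only [χ]
      exact max_eq_left ((min_le_right _ _).trans (by linarith))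
    simp [ψ, this]
  let S : Set (EuclideanSpace ℝ (Fin n)) := {x | C + 3 ≤ ‖x‖}
  let U : Set (EuclideanSpace ℝ (Fin n)) := {x | C + 2 < ‖x‖}
  have hS : IsClosed S := isClosed_le continuous_const continuous_norm
  have hU : IsOpen U := isOpen_lt continuous_const continuous_norm
  have hSU : S ⊆ U := fun x (hx : C + 3 ≤ ‖x‖) => show C + 2 < ‖x‖ by linarith
  obtain ⟨g, hg, hga, hgS, -⟩ := hψc.exists_contDiff_approx_and_eqOn 1 (ε := fun x => ‖ψ x‖)
    hψc.norm (fun x => norm_pos_iff.2 (hψ0 x)) hS (hU.mem_nhdsSet.2 hSU)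
    (contDiffOn_id.congr fun x hx => hψid x (le_of_lt hx))
  have hg0 : ∀ x, g x ≠ 0 := by
    intro x hx
    have := hga x
    rw [hx, dist_zero_left] at this
    exact lt_irrefl _ this
  have hM : 0 < C + 3 := by linarith
  refine no_retraction hM (fun x => ((C + 3) / ‖g x‖) • g x) ?_ ?_ ?_
  · have hn : ContDiff ℝ 1 (fun x => ‖g x‖) := hg.norm ℝ hg0
    exact (contDiff_const.div hn fun x => norm_ne_zero_iff.2 (hg0 x)).smul hg
  · intro x
    rw [norm_smul, norm_div, norm_norm, Real.norm_of_nonneg hM.le,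
      div_mul_cancel₀ _ (norm_ne_zero_iff.2 (hg0 x))]
  · intro x hx
    have : g x = x := (hgS (show C + 3 ≤ ‖x‖ from hx.ge)).trans (hψid x (by linarith))
    simp only [this, hx]
    rw [div_self hM.ne', one_smul]

theorem closedEmbedding_hits_zero {n : ℕ}
    (f : EuclideanSpace ℝ (Fin n) → EuclideanSpace ℝ (Fin n))
    (hf : Topology.IsClosedEmbedding f) : ∃ x, f x = 0 := by
  by_contra! hne
  obtain ⟨G, hG⟩ := ContinuousMap.exists_extension hf (ContinuousMap.id _)
  have hGf : ∀ x, G (f x) = x := fun x => congrArg (fun k => k x) hG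
  obtain ⟨R0, hR0⟩ := (isCompact_closedBall (0 : EuclideanSpace ℝ (Fin n)) 2).exists_bound_of_continuousOn
    hf.continuous.continuousOn
  let R : ℝ := max R0 0 + 1
  have hR : 0 < R := by positivity
  have hfR : ∀ x, R ≤ ‖f x‖ → 2 < ‖x‖ := by
    intro x hx
    by_contra! h
    have h1 := hR0 x (by simpa using h)
    have h2 : R0 ≤ max R0 0 := le_max_left _ _
    simp only [R] at hx
    linarith
  obtain ⟨P, hP, hPa, -⟩ := G.continuous.exists_contDiff_approx 1 (ε := fun _ => 1 / 2)
    continuous_const (fun _ => by norm_num)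
  have hnull : volume (P '' sphere 0 R) = 0 :=
    addHaar_image_eq_zero_of_differentiableOn_of_addHaar_eq_zero volume
      (hP.differentiable (by norm_num)).differentiableOn (Measure.addHaar_sphere_of_ne_zero _ _ hR.ne')
  obtain ⟨v, hv, hvP⟩ : ∃ v ∈ ball (0 : EuclideanSpace ℝ (Fin n)) (1 / 2), v ∉ P '' sphere 0 R := by
    by_contra! h
    have := measure_mono_null h hnull
    exact (measure_ball_pos volume (0 : EuclideanSpace ℝ (Fin n)) (by norm_num : (0:ℝ) < 1/2)).ne' this
  let D : EuclideanSpace ℝ (Fin n) → EuclideanSpace ℝ (Fin n) := fun y => P y - v - G y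
  have hDc : Continuous D := (hP.continuous.sub continuous_const).sub G.continuous
  have hD : ∀ y, ‖D y‖ ≤ 1 := by
    intro y
    have h1 := hPa y
    rw [dist_eq_norm] at h1
    have h2 : ‖v‖ < 1 / 2 := by simpa using hv
    have h3 : D y = (P y - G y) - v := by simp only [D]; abel
    rw [h3]
    linarith [norm_sub_le (P y - G y) v]
  let π : EuclideanSpace ℝ (Fin n) → EuclideanSpace ℝ (Fin n) := fun y => (R / ‖y‖) • y
  let ρ : EuclideanSpace ℝ (Fin n) → EuclideanSpace ℝ (Fin n) := fun y => (max R ‖y‖ / ‖y‖) • y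
  have hfn : ∀ x, ‖f x‖ ≠ 0 := fun x => norm_ne_zero_iff.2 (hne x)
  have hρ1 : ∀ x, R ≤ ‖f x‖ → ρ (f x) = f x := by
    intro x hx
    simp only [ρ]
    rw [max_eq_right hx, div_self (hfn x), one_smul]
  have hρ2 : ∀ x, ‖f x‖ ≤ R → ρ (f x) = π (f x) := by
    intro x hx
    simp only [ρ, π]
    rw [max_eq_left hx]
  have hπ : ∀ x, ‖π (f x)‖ = R := by
    intro x
    simp only [π]
    rw [norm_smul, norm_div, norm_norm, Real.norm_of_nonneg hR.le, div_mul_cancel₀ _ (hfn x)]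
  let φ : EuclideanSpace ℝ (Fin n) → EuclideanSpace ℝ (Fin n) :=
    fun x => x - (G (ρ (f x)) + D (π (f x)))
  have hfc := hf.continuous
  have hφc : Continuous φ := by
    have c1 : Continuous fun x => π (f x) :=
      (continuous_const.div hfc.norm hfn).smul hfc
    have c2 : Continuous fun x => ρ (f x) :=
      ((continuous_const.max hfc.norm).div hfc.norm hfn).smul hfc
    exact continuous_id.sub ((G.continuous.comp c2).add (hDc.comp c1))
  obtain ⟨B1, hB1⟩ := (isCompact_closedBall (0 : EuclideanSpace ℝ (Fin n)) R).exists_bound_of_continuousOn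
    G.continuous.continuousOn
  have hφ1 : ∀ x, R ≤ ‖f x‖ → φ x = - D (π (f x)) := by
    intro x hx
    simp only [φ]
    rw [hρ1 x hx, hGf]; abel
  obtain ⟨x, hx⟩ := bounded_fixed_point φ hφc (C := max 1 (B1 + B1 + 1)) (by
    intro x
    rcases le_total R ‖f x‖ with h | h
    · rw [hφ1 x h, norm_neg]
      exact (hD _).trans (le_max_left _ _)
    · refine le_trans ?_ (le_max_right _ _)
      have a1 : ‖x‖ ≤ B1 := by
        have := hB1 (f x) (by simpa using h)
        rwa [hGf] at this
      have a2 : ‖G (ρ (f x))‖ ≤ B1 := by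
        apply hB1
        rw [hρ2 x h]; simp [hπ]
      have a3 := hD (π (f x))
      have a4 := norm_sub_le x (G (ρ (f x)) + D (π (f x)))
      have a5 := norm_add_le (G (ρ (f x))) (D (π (f x)))
      simp only [φ]
      linarith)
  rcases le_total R ‖f x‖ with h | h
  · have h1 := hφ1 x h
    rw [hx] at h1
    have h2 := hfR x h
    have h3 := hD (π (f x))
    rw [h1, norm_neg] at h2
    linarith
  · have h1 : G (ρ (f x)) + D (π (f x)) = 0 := by
      simpa [φ] using hx
    rw [hρ2 x h] at h1
    apply hvP
    refine ⟨π (f x), by simp [hπ], ?_⟩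
    simp only [D] at h1
    have : P (π (f x)) - v = 0 := by rw [← h1]; abel
    exact sub_eq_zero.1 this

theorem closedEmbedding_surjective {n : ℕ}
    (f : EuclideanSpace ℝ (Fin n) → EuclideanSpace ℝ (Fin n))
    (hf : Topology.IsClosedEmbedding f) : Function.Surjective f := by
  intro c
  obtain ⟨x, hx⟩ := closedEmbedding_hits_zero _
    ((Homeomorph.addRight (-c)).isClosedEmbedding.comp hf)
  exact ⟨x, by simpa [add_neg_eq_zero] using hx⟩

/-- Let `X`, `Y` be compact Hausdorff spaces, `A ⊆ X`, `B ⊆ Y` closed,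
and `f : X → Y` continuous with `A = f⁻¹(B)`. Assume the restriction of `f` to `X∖A` is
injective and an open map onto its image inside `Y∖B`, and that `X∖A` and `Y∖B` are both
homeomorphic to `ℝⁿ`. Then `f` maps `X∖A` onto `Y∖B`. -/
theorem compact_pair_open_injective_surjective
    {X Y : Type*} [TopologicalSpace X] [TopologicalSpace Y]
    [CompactSpace X] [T2Space X] [CompactSpace Y] [T2Space Y]
    (A : Set X) (B : Set Y) (hA : IsClosed A) (hB : IsClosed B)
    (f : X → Y) (hf : Continuous f) (hAB : A = f ⁻¹' B)
    (hinj : Set.InjOn f Aᶜ)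
    (hopen : ∀ U : Set X, IsOpen U → ∃ W : Set Y, IsOpen W ∧ f '' (U ∩ Aᶜ) = W ∩ f '' Aᶜ)
    (n : ℕ)
    (hX : Nonempty (↥Aᶜ ≃ₜ (Fin n → ℝ))) (hY : Nonempty (↥Bᶜ ≃ₜ (Fin n → ℝ))) :
    f '' Aᶜ = Bᶜ := by
  obtain ⟨eX⟩ := hX
  obtain ⟨eY⟩ := hY
  have hmaps : MapsTo f Aᶜ Bᶜ := by
    intro x hx hfx
    exact hx (by rw [hAB]; exact hfx)
  let g : ↥Aᶜ → ↥Bᶜ := hmaps.restrict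
  have hgc : Continuous g := hf.restrict hmaps
  have hgi : Function.Injective g := hmaps.restrict_inj.2 hinj
  have hgcl : IsClosedMap g := by
    intro Z hZ
    obtain ⟨Z', hZ', rfl⟩ := isClosed_induced_iff.1 hZ
    refine isClosed_induced_iff.2 ⟨f '' Z', (hZ'.isCompact.image hf).isClosed, ?_⟩
    ext y
    constructor
    · rintro ⟨x, hx, hxy⟩
      have hxA : x ∈ Aᶜ := by
        intro h
        rw [hAB] at h
        exact y.2 (hxy ▸ h)
      exact ⟨⟨x, hxA⟩, hx, Subtype.ext hxy⟩
    · rintro ⟨x, hx, rfl⟩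
      exact ⟨x, hx, rfl⟩
  have hg : Topology.IsClosedEmbedding g := .of_continuous_injective_isClosedMap hgc hgi hgcl
  let e := (EuclideanSpace.equiv (Fin n) ℝ).toHomeomorph
  have hsurj := closedEmbedding_surjective _ (((eY.trans e.symm).isClosedEmbedding.comp hg).comp
    (eX.symm.isClosedEmbedding.comp e.isClosedEmbedding))
  refine Subset.antisymm hmaps.image_subset fun y hy => ?_
  obtain ⟨z, hz⟩ := hsurj ((eY.trans e.symm) ⟨y, hy⟩)
  have hz' := (eY.trans e.symm).injective hz
  exact ⟨_, (eX.symm (e z)).2, congrArg Subtype.val hz'⟩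
end
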